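/- Let E be a finite-dimensional real normed vector space and let f_0, …, f_k : E → ℝ be affine functions such that: (i) there exist real numbers c_0, …, c_k > 0 with c_0·f_0(v) + ⋯ + c_k·f_k(v) = 1 for every v ∈ E; and (ii) the linear parts of f_0, …, f_k span the dual space E*. Then for every real s the set {v ∈ E : f_i(v) ≤ s for all i} is bounded (hence compact, being closed), and the set {v ∈ E : f_i(v) ≤ 0 for all i} is empty. -/

import Mathlib

/-- A vector on which a spanning family of linear functionals vanishes is zero. -/
theorem injective_pi_of_span_range_eq_top {K V ι : Type*} [Field K] [AddCommGroup V]
    [Module K V] (g : ι → Module.Dual K V) (hg : Submodule.span K (Set.range g) = ⊤) :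
    Function.Injective (LinearMap.pi g) := by
  refine (injective_iff_map_eq_zero _).2 fun v hv => ?_
  refine (Module.forall_dual_apply_eq_zero_iff K v).1 fun φ => ?_
  have hle : Submodule.span K (Set.range g) ≤ LinearMap.ker (Module.Dual.eval K V v) :=
    Submodule.span_le.2 <| Set.range_subset_iff.2 fun i => congrFun hv i
  exact (hg ▸ hle) (Submodule.mem_top (x := φ))

/-- If a positive combination of reals bounded above by `s` is fixed, then each of them is
bounded below. -/
theorem div_le_of_sum_mul_eq_of_forall_le {ι : Type*} [Fintype ι] [DecidableEq ι]
    {c x : ι → ℝ} {s t : ℝ} (hc : ∀ i, 0 < c i) (hsum : ∑ i, c i * x i = t)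
    (hx : ∀ i, x i ≤ s) (i : ι) :
    (t - ∑ j ∈ Finset.univ.erase i, c j * s) / c i ≤ x i := by
  rw [div_le_iff₀ (hc i)]
  have hle : ∑ j ∈ Finset.univ.erase i, c j * x j ≤ ∑ j ∈ Finset.univ.erase i, c j * s :=
    Finset.sum_le_sum fun j _ => mul_le_mul_of_nonneg_left (hx j) (hc j).le
  have hsplit := Finset.add_sum_erase Finset.univ (fun j => c j * x j) (Finset.mem_univ i)
  linarith

/-- Let `E` be a finite-dimensional real normed vector space and `f 0, …, f k : E → ℝ`
affine functions such that (i) some positive combination `∑ i, c i • f i` is identically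
`1`, and (ii) the linear parts of the `f i` span the dual space `E*`. Then for every real
`s` the set `{v : ∀ i, f i v ≤ s}` is bounded, hence compact (being closed), and the set
`{v : ∀ i, f i v ≤ 0}` is empty. -/
theorem affine_sublevel_compact_and_empty
    {E : Type*} [NormedAddCommGroup E] [NormedSpace ℝ E] [FiniteDimensional ℝ E]
    {k : ℕ} (f : Fin (k + 1) → E →ᵃ[ℝ] ℝ)
    (c : Fin (k + 1) → ℝ) (hc : ∀ i, 0 < c i)
    (hsum : ∀ v : E, ∑ i, c i * f i v = 1)
    (hspan : Submodule.span ℝ (Set.range fun i => (f i).linear) = ⊤) :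
    (∀ s : ℝ, Bornology.IsBounded {v : E | ∀ i, f i v ≤ s} ∧
      IsCompact {v : E | ∀ i, f i v ≤ s}) ∧
      {v : E | ∀ i, f i v ≤ 0} = ∅ := by
  have hcompact (s : ℝ) : IsCompact {v : E | ∀ i, f i v ≤ s} := by
    set Φ : E →ₗ[ℝ] Fin (k + 1) → ℝ := LinearMap.pi fun i => (f i).linear with hΦ
    have hemb : Topology.IsClosedEmbedding Φ :=
      LinearMap.isClosedEmbedding_of_injective
        (LinearMap.ker_eq_bot.2 (injective_pi_of_span_range_eq_top _ hspan))
    have hclosed : IsClosed {v : E | ∀ i, f i v ≤ s} := by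
      simp only [Set.ofPred_forall]
      exact isClosed_iInter fun i =>
        isClosed_le (f i).continuous_of_finiteDimensional continuous_const
    let a : Fin (k + 1) → ℝ := fun i => (1 - ∑ j ∈ Finset.univ.erase i, c j * s) / c i - f i 0
    let b : Fin (k + 1) → ℝ := fun i => s - f i 0
    refine (hemb.isCompact_preimage (isCompact_Icc (a := a) (b := b))).of_isClosed_subset
      hclosed fun v hv => ?_
    have happly (i : Fin (k + 1)) : Φ v i = f i v - f i 0 := by
      simp [hΦ, (f i).decomp']
    refine ⟨fun i => ?_, fun i => ?_⟩
    · rw [happly]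
      exact sub_le_sub_right (div_le_of_sum_mul_eq_of_forall_le hc (hsum v) hv i) _
    · rw [happly]
      exact sub_le_sub_right (hv i) _
  refine ⟨fun s => ⟨(hcompact s).isBounded, hcompact s⟩, ?_⟩
  refine Set.eq_empty_of_forall_notMem fun v hv => ?_
  have hnonpos : ∑ i, c i * f i v ≤ 0 :=
    Finset.sum_nonpos fun i _ => mul_nonpos_of_nonneg_of_nonpos (hc i).le (hv i)
  linarith [hsum v]
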